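/- Let N be a positive integer and let φ be a measurable function on [0,1) integrable with respect to μ_N. Then for Lebesgue almost every x ∈ [0,1), the Birkhoff averages converge: lim_{n→∞} (1/n) Σ_{k=0}^{n-1} φ(T_N^k(x)) = ∫_{[0,1)} φ dμ_N = (1/(ln(N+1) − ln N)) ∫_0^1 φ(t)/(N + t) dt. -/

import Mathlib

open MeasureTheory Filter Set

/-- The generalized Gauss transformation `T_N(x) = {N/x}` (and `T_N(0) = 0`). -/
noncomputable def gaussT (N : ℕ) (x : ℝ) : ℝ :=
  if x = 0 then 0 else Int.fract ((N : ℝ) / x)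

/-- The measure `μ_N` on `[0,1)` with density
`x ↦ 1 / ((log (N+1) - log N) * (N + x))` w.r.t. Lebesgue measure. -/
noncomputable def gaussMu (N : ℕ) : Measure ℝ :=
  (volume.restrict (Set.Ico (0:ℝ) 1)).withDensity
    (fun x => ENNReal.ofReal (1 / ((Real.log (N + 1) - Real.log N) * (N + x))))

/-- The running maxima `max (0, S₁ f, …, Sₙ f)` of the Birkhoff sums of `f` along `T`. -/
noncomputable def birkhoffMax {α : Type*} (T : α → α) (f : α → ℝ) : ℕ → α → ℝ
  | 0 => fun _ => 0
  | n + 1 => fun x => max 0 (f x + birkhoffMax T f n (T x))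

section BirkhoffMax

variable {α : Type*} {T : α → α} {f : α → ℝ}

theorem birkhoffMax_nonneg (n : ℕ) (x : α) : 0 ≤ birkhoffMax T f n x := by
  cases n with
  | zero => exact le_rfl
  | succ n => exact le_max_left _ _

theorem birkhoffMax_le_succ (n : ℕ) (x : α) :
    birkhoffMax T f n x ≤ birkhoffMax T f (n + 1) x := by
  induction n generalizing x with
  | zero => exact le_max_left _ _
  | succ n ih => exact max_le_max le_rfl (add_le_add le_rfl (ih _))

theorem birkhoffMax_mono (x : α) : Monotone fun n => birkhoffMax T f n x :=
  monotone_nat_of_le_succ fun n => birkhoffMax_le_succ n x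

theorem birkhoffSum_le_birkhoffMax (n : ℕ) (x : α) :
    birkhoffSum T f n x ≤ birkhoffMax T f n x := by
  induction n generalizing x with
  | zero => simp [birkhoffMax]
  | succ n ih =>
    rw [birkhoffSum_succ']
    exact le_max_of_le_right (add_le_add le_rfl (ih _))

theorem tendsto_birkhoffMax_atTop {x : α}
    (h : ¬ BddAbove (range fun n => birkhoffSum T f n x)) :
    Tendsto (fun n => birkhoffMax T f n x) atTop atTop := by
  refine tendsto_atTop_atTop_of_monotone (birkhoffMax_mono x) fun b => ?_
  obtain ⟨_, ⟨n, rfl⟩, hn⟩ := not_bddAbove_iff.1 h b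
  exact ⟨n, hn.le.trans (birkhoffSum_le_birkhoffMax n x)⟩

theorem bddAbove_birkhoffSum_apply_iff (x : α) :
    BddAbove (range fun n => birkhoffSum T f n (T x)) ↔
      BddAbove (range fun n => birkhoffSum T f n x) := by
  constructor
  · rintro ⟨b, hb⟩
    refine ⟨max 0 (f x + b), ?_⟩
    rintro _ ⟨n, rfl⟩
    cases n with
    | zero => simp
    | succ n =>
      simp only [birkhoffSum_succ']
      exact le_max_of_le_right (add_le_add le_rfl (hb ⟨n, rfl⟩))
  · rintro ⟨b, hb⟩
    refine ⟨b - f x, ?_⟩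
    rintro _ ⟨n, rfl⟩
    have := hb ⟨n + 1, rfl⟩
    simp only [birkhoffSum_succ'] at this
    simpa [le_sub_iff_add_le'] using this

variable [MeasurableSpace α] {μ : Measure α}

theorem measurable_birkhoffSum (hT : Measurable T) (hf : Measurable f) (n : ℕ) :
    Measurable (birkhoffSum T f n) := by
  unfold birkhoffSum
  exact Finset.measurable_fun_sum _ fun k _ => hf.comp (hT.iterate k)

theorem integrable_birkhoffMax (hT : MeasurePreserving T μ μ) (hf : Integrable f μ) (n : ℕ) :
    Integrable (birkhoffMax T f n) μ := by
  induction n with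
  | zero => exact integrable_zero _ _ _
  | succ n ih =>
    exact (integrable_zero _ _ _).sup (hf.add (hT.integrable_comp_of_integrable ih))

/-- A function of negative mean has almost surely bounded-above Birkhoff sums along an ergodic
transformation. -/
theorem Ergodic.ae_bddAbove_birkhoffSum (hT : Ergodic T μ) (hfm : Measurable f)
    (hf : Integrable f μ) (hneg : ∫ x, f x ∂μ < 0) :
    ∀ᵐ x ∂μ, BddAbove (range fun n => birkhoffSum T f n x) := by
  have hTp : MeasurePreserving T μ μ := hT.toMeasurePreserving
  have hms : MeasurableSet {x | BddAbove (range fun n => birkhoffSum T f n x)} :=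
    measurableSet_bddAbove_range fun n => measurable_birkhoffSum hTp.measurable hfm n
  have hinv : T ⁻¹' {x | BddAbove (range fun n => birkhoffSum T f n x)} =
      {x | BddAbove (range fun n => birkhoffSum T f n x)} := by
    ext x
    exact bddAbove_birkhoffSum_apply_iff x
  rcases hT.toPreErgodic.ae_empty_or_univ hms hinv with h | h
  swap
  · filter_upwards [h] with x hx
    exact hx.mpr trivial
  exfalso
  have hM := fun n => integrable_birkhoffMax hTp hf n
  have hMT (n : ℕ) : Integrable (fun x => birkhoffMax T f n (T x)) μ :=
    hTp.integrable_comp_of_integrable (hM n)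
  have hstep (n : ℕ) (x : α) : max (-birkhoffMax T f n (T x)) (f x) =
      birkhoffMax T f (n + 1) x - birkhoffMax T f n (T x) := by
    simp only [birkhoffMax]
    rw [← max_sub_sub_right]
    simp
  have hnonneg (n : ℕ) : 0 ≤ ∫ x, max (-birkhoffMax T f n (T x)) (f x) ∂μ := by
    simp only [hstep]
    have hcomp : ∫ x, birkhoffMax T f n (T x) ∂μ = ∫ x, birkhoffMax T f n x ∂μ := by
      have h1 := integral_map (μ := μ) hTp.measurable.aemeasurable
        (f := birkhoffMax T f n) (by rw [hTp.map_eq]; exact (hM n).aestronglyMeasurable)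
      rw [hTp.map_eq] at h1
      exact h1.symm
    rw [integral_sub (hM _) (hMT n), hcomp, sub_nonneg]
    exact integral_mono (hM _) (hM _) fun x => birkhoffMax_le_succ n x
  have hlim : Tendsto (fun n => ∫ x, max (-birkhoffMax T f n (T x)) (f x) ∂μ) atTop
      (nhds (∫ x, f x ∂μ)) := by
    refine tendsto_integral_of_dominated_convergence (fun x => |f x|) (fun n => ?_) hf.abs
      (fun n => ae_of_all _ fun x => ?_) ?_
    · exact ((hMT n).neg.sup hf).aestronglyMeasurable
    · have h0 := birkhoffMax_nonneg (T := T) (f := f) n (T x)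
      rw [Real.norm_eq_abs, abs_le]
      exact ⟨(neg_abs_le _).trans (le_max_right _ _),
        max_le (by linarith [abs_nonneg (f x)]) (le_abs_self _)⟩
    · filter_upwards [h] with x hx
      have hx' : ¬ BddAbove (range fun n => birkhoffSum T f n (T x)) := fun hb =>
        hx.mp ((bddAbove_birkhoffSum_apply_iff x).1 hb)
      refine tendsto_const_nhds.congr' ?_
      filter_upwards [(tendsto_birkhoffMax_atTop hx').eventually_ge_atTop (-f x)] with n hn
      rw [max_eq_right (by linarith)]
  exact absurd (ge_of_tendsto' hlim hnonneg) (not_le.2 hneg)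

theorem Ergodic.ae_eventually_birkhoffAverage_lt [IsProbabilityMeasure μ] (hT : Ergodic T μ)
    (hfm : Measurable f) (hf : Integrable f μ) {c : ℝ} (hc : ∫ x, f x ∂μ < c) :
    ∀ᵐ x ∂μ, ∀ᶠ n in atTop, birkhoffAverage ℝ T f n x < c := by
  obtain ⟨d, hd, hdc⟩ := exists_between hc
  have h := hT.ae_bddAbove_birkhoffSum (f := fun x => f x - d) (hfm.sub_const d)
    (hf.sub (integrable_const d)) (by
      rw [integral_sub hf (integrable_const d)]
      simpa using hd)
  filter_upwards [h] with x ⟨b, hb⟩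
  have hlim : Tendsto (fun n : ℕ => b / (n : ℝ)) atTop (nhds 0) :=
    tendsto_const_div_atTop_nhds_zero_nat b
  filter_upwards [hlim.eventually_lt_const (sub_pos.2 hdc), eventually_gt_atTop 0] with n hn hn0
  have hn0' : (0 : ℝ) < n := by exact_mod_cast hn0
  have h1 : birkhoffSum T f n x - n * d ≤ b := by
    have := hb ⟨n, rfl⟩
    simpa [birkhoffSum, Finset.sum_sub_distrib] using this
  rw [div_lt_iff₀ hn0'] at hn
  rw [birkhoffAverage, smul_eq_mul, inv_mul_lt_iff₀ hn0']
  linarith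

/-- Birkhoff's pointwise ergodic theorem for an ergodic transformation of a probability space. -/
theorem Ergodic.ae_tendsto_birkhoffAverage [IsProbabilityMeasure μ] (hT : Ergodic T μ)
    (hfm : Measurable f) (hf : Integrable f μ) :
    ∀ᵐ x ∂μ, Tendsto (fun n => birkhoffAverage ℝ T f n x) atTop (nhds (∫ x, f x ∂μ)) := by
  have hpos (k : ℕ) : (0 : ℝ) < 1 / (k + 1) := by positivity
  have hup := ae_all_iff.2 fun k : ℕ =>
    hT.ae_eventually_birkhoffAverage_lt hfm hf (lt_add_of_pos_right _ (hpos k))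
  have hlow := ae_all_iff.2 fun k : ℕ =>
    hT.ae_eventually_birkhoffAverage_lt (f := -f) hfm.neg hf.neg
      (lt_add_of_pos_right _ (hpos k))
  filter_upwards [hup, hlow] with x h1 h2
  rw [Metric.tendsto_nhds]
  intro ε hε
  obtain ⟨k, hk⟩ := exists_nat_one_div_lt hε
  filter_upwards [h1 k, h2 k] with n hn1 hn2
  simp only [birkhoffAverage_neg, Pi.neg_apply, integral_neg] at hn2
  rw [Real.dist_eq, abs_lt]
  constructor <;> linarith

end BirkhoffMax

/-- The inverse branches `y ↦ N / (N + i + y)` of `gaussT N`. -/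
noncomputable def gaussBranch (N i : ℕ) (y : ℝ) : ℝ := N / (N + i + y)

/-- The weights of the transfer operator of `gaussT N` with respect to `gaussMu N`. -/
noncomputable def gaussWeight (N i : ℕ) (y : ℝ) : ℝ :=
  (N + y) / ((N + i + y) * (N + i + 1 + y))

/-- The transfer operator of `gaussT N` with respect to `gaussMu N`. -/
noncomputable def gaussTransfer (N : ℕ) (f : ℝ → ℝ) (y : ℝ) : ℝ :=
  ∑' i, gaussWeight N i y * f (gaussBranch N i y)

theorem measurable_gaussT (N : ℕ) : Measurable (gaussT N) := by
  unfold gaussT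
  exact Measurable.ite (measurableSet_singleton 0) measurable_const
    (measurable_const.div measurable_id).fract

theorem measurable_gaussBranch (N i : ℕ) : Measurable (gaussBranch N i) := by
  unfold gaussBranch; fun_prop

theorem measurable_gaussWeight (N i : ℕ) : Measurable (gaussWeight N i) := by
  unfold gaussWeight; fun_prop

theorem measurable_gaussTransfer {f : ℝ → ℝ} (N : ℕ) (hf : Measurable f) :
    Measurable (gaussTransfer N f) :=
  Measurable.tsum fun i =>
    (measurable_gaussWeight N i).mul (hf.comp (measurable_gaussBranch N i))

section GaussMap

variable {N : ℕ}

theorem gaussNorm_pos (hN : 0 < N) : 0 < Real.log (N + 1) - Real.log N := by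
  have h : (0 : ℝ) < N := by exact_mod_cast hN
  exact sub_pos.2 (Real.log_lt_log h (by linarith))

theorem gaussBranch_mem_Ioc (hN : 0 < N) (i : ℕ) {y : ℝ} (hy : 0 ≤ y) :
    gaussBranch N i y ∈ Ioc (0 : ℝ) 1 := by
  have h : (0 : ℝ) < N := by exact_mod_cast hN
  have hi : (0 : ℝ) ≤ i := i.cast_nonneg
  exact ⟨by unfold gaussBranch; positivity, (div_le_one (by positivity)).2 (by linarith)⟩

theorem div_gaussBranch (hN : 0 < N) (i : ℕ) (y : ℝ) :
    (N : ℝ) / gaussBranch N i y = N + i + y := by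
  have h : (N : ℝ) ≠ 0 := by exact_mod_cast hN.ne'
  rw [gaussBranch, div_div_cancel₀ h]

theorem gaussT_gaussBranch (hN : 0 < N) (i : ℕ) {y : ℝ} (hy : y ∈ Ico (0 : ℝ) 1) :
    gaussT N (gaussBranch N i y) = y := by
  rw [gaussT, if_neg (gaussBranch_mem_Ioc hN i hy.1).1.ne', div_gaussBranch hN, add_comm,
    ← Nat.cast_add, Int.fract_add_natCast, Int.fract_eq_self.2 hy]

theorem iUnion_image_gaussBranch (hN : 0 < N) :
    ⋃ i, gaussBranch N i '' Ico (0 : ℝ) 1 = Ioc 0 1 := by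
  have h : (0 : ℝ) < N := by exact_mod_cast hN
  ext x
  simp only [mem_iUnion, mem_image]
  constructor
  · rintro ⟨i, y, hy, rfl⟩
    exact gaussBranch_mem_Ioc hN i hy.1
  · rintro ⟨hx0, hx1⟩
    have hle : (N : ℝ) ≤ N / x := (le_div_iff₀ hx0).2 (by nlinarith)
    have hfl : N ≤ ⌊(N : ℝ) / x⌋₊ := Nat.le_floor hle
    refine ⟨⌊(N : ℝ) / x⌋₊ - N, N / x - ⌊(N : ℝ) / x⌋₊, ⟨?_, ?_⟩, ?_⟩
    · exact sub_nonneg.2 (Nat.floor_le (by positivity))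
    · linarith [Nat.lt_floor_add_one ((N : ℝ) / x)]
    · rw [gaussBranch, Nat.cast_sub hfl, add_sub_cancel, add_sub_cancel, div_div_cancel₀ h.ne']

theorem pairwise_disjoint_image_gaussBranch (hN : 0 < N) :
    Pairwise (Function.onFun Disjoint fun i => gaussBranch N i '' Ico (0 : ℝ) 1) := by
  intro i j hij
  refine Set.disjoint_left.2 ?_
  rintro _ ⟨y, hy, rfl⟩ ⟨z, hz, hzy⟩
  have heq : (N : ℝ) + j + z = N + i + y := by
    rw [← div_gaussBranch hN, hzy, div_gaussBranch hN]
  have h1 : (i : ℝ) < j + 1 := by linarith [hy.1, hz.2]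
  have h2 : (j : ℝ) < i + 1 := by linarith [hz.1, hy.2]
  norm_cast at h1 h2
  omega

theorem injOn_gaussBranch (hN : 0 < N) (i : ℕ) : InjOn (gaussBranch N i) (Ico 0 1) :=
  fun y hy z hz hyz => by
    rw [← gaussT_gaussBranch hN i hy, hyz, gaussT_gaussBranch hN i hz]

theorem hasDerivAt_gaussBranch (hN : 0 < N) (i : ℕ) {y : ℝ} (hy : 0 ≤ y) :
    HasDerivAt (gaussBranch N i) (-N / (N + i + y) ^ 2) y := by
  have h : (0 : ℝ) < N := by exact_mod_cast hN
  have hne : (N : ℝ) + i + y ≠ 0 := by positivity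
  have := (hasDerivAt_const y (N : ℝ)).fun_div ((hasDerivAt_id y).const_add ((N : ℝ) + i)) hne
  simpa only [gaussBranch, id_eq, zero_mul, mul_one, zero_sub] using! this

theorem measurable_gaussDensity (N : ℕ) : Measurable fun x : ℝ =>
    ENNReal.ofReal (1 / ((Real.log (N + 1) - Real.log N) * (N + x))) := by
  fun_prop

theorem lintegral_gaussMu {F : ℝ → ENNReal} (hF : Measurable F) :
    ∫⁻ x, F x ∂gaussMu N = ∫⁻ x in Ico 0 1,
      ENNReal.ofReal (1 / ((Real.log (N + 1) - Real.log N) * (N + x))) * F x := by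
  rw [gaussMu, lintegral_withDensity_eq_lintegral_mul _ (measurable_gaussDensity N) hF]
  rfl

theorem ae_gaussMu_mem_Ico (N : ℕ) : ∀ᵐ x ∂gaussMu N, x ∈ Ico (0 : ℝ) 1 :=
  (withDensity_absolutelyContinuous _ _).ae_le (ae_restrict_mem measurableSet_Ico)

theorem measurable_gaussWeight_mul_comp (i : ℕ) {F : ℝ → ENNReal} (hF : Measurable F) :
    Measurable fun y => ENNReal.ofReal (gaussWeight N i y) * F (gaussBranch N i y) :=
  (measurable_gaussWeight N i).ennreal_ofReal.mul (hF.comp (measurable_gaussBranch N i))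

theorem lintegral_gaussMu_eq_tsum (hN : 0 < N) {F : ℝ → ENNReal} (hF : Measurable F) :
    ∫⁻ x, F x ∂gaussMu N =
      ∑' i, ∫⁻ y, ENNReal.ofReal (gaussWeight N i y) * F (gaussBranch N i y) ∂gaussMu N := by
  have h : (0 : ℝ) < N := by exact_mod_cast hN
  have hc := gaussNorm_pos hN
  have hderiv (i : ℕ) (y : ℝ) (hy : y ∈ Ico (0 : ℝ) 1) :
      HasDerivWithinAt (gaussBranch N i) (-N / (N + i + y) ^ 2) (Ico 0 1) y :=
    (hasDerivAt_gaussBranch hN i hy.1).hasDerivWithinAt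
  rw [lintegral_gaussMu hF, setLIntegral_congr Ico_ae_eq_Ioc, ← iUnion_image_gaussBranch hN,
    lintegral_iUnion (fun i => measurableSet_Ico.image_of_measurable_injOn
      (measurable_gaussBranch N i) (injOn_gaussBranch hN i))
      (pairwise_disjoint_image_gaussBranch hN)]
  refine tsum_congr fun i => ?_
  rw [lintegral_image_eq_lintegral_abs_deriv_mul measurableSet_Ico (hderiv i)
    (injOn_gaussBranch hN i), lintegral_gaussMu (measurable_gaussWeight_mul_comp i hF)]
  refine setLIntegral_congr_fun measurableSet_Ico fun y hy => ?_
  have hy0 := hy.1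
  have hi : (0 : ℝ) ≤ i := i.cast_nonneg
  rw [← mul_assoc, ← mul_assoc, ← ENNReal.ofReal_mul (abs_nonneg _),
    ← ENNReal.ofReal_mul (by positivity)]
  congr 2
  rw [neg_div, abs_neg, abs_of_nonneg (by positivity), gaussBranch, gaussWeight]
  generalize Real.log (N + 1) - Real.log N = c at *
  field_simp
  ring

theorem isProbabilityMeasure_gaussMu (hN : 0 < N) : IsProbabilityMeasure (gaussMu N) := by
  have h : (0 : ℝ) < N := by exact_mod_cast hN
  have hc := gaussNorm_pos hN
  have hcont : ContinuousOn
      (fun x : ℝ => 1 / ((Real.log (N + 1) - Real.log N) * (N + x))) (Icc 0 1) := by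
    refine continuousOn_const.div (by fun_prop) fun x hx => ?_
    have := hx.1
    positivity
  have hint : IntegrableOn
      (fun x : ℝ => 1 / ((Real.log (N + 1) - Real.log N) * (N + x))) (Ico 0 1) :=
    hcont.integrableOn_Icc.mono_set Ico_subset_Icc_self
  have hval : ∫ x in (0 : ℝ)..1, 1 / ((Real.log (N + 1) - Real.log N) * (N + x)) = 1 := by
    simp_rw [mul_comm (Real.log (N + 1) - Real.log N), ← div_div]
    rw [intervalIntegral.integral_div,
      intervalIntegral.integral_comp_add_left (fun x : ℝ => 1 / x), integral_one_div_of_pos,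
      add_zero, Real.log_div, div_self hc.ne']
    all_goals positivity
  refine ⟨?_⟩
  rw [gaussMu, withDensity_apply _ MeasurableSet.univ, Measure.restrict_univ,
    ← ofReal_integral_eq_lintegral_ofReal hint, integral_Ico_eq_integral_Ioc,
    ← intervalIntegral.integral_of_le zero_le_one, hval, ENNReal.ofReal_one]
  refine (ae_restrict_iff' measurableSet_Ico).2 (ae_of_all _ fun x hx => ?_)
  have := hx.1
  change 0 ≤ 1 / ((Real.log (N + 1) - Real.log N) * (N + x))
  positivity

theorem gaussWeight_nonneg (i : ℕ) {y : ℝ} (hy : 0 ≤ y) : 0 ≤ gaussWeight N i y := by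
  unfold gaussWeight; positivity

theorem gaussWeight_eq_sub (hN : 0 < N) (i : ℕ) {y : ℝ} (hy : 0 ≤ y) :
    gaussWeight N i y = (N + y) / (N + (i : ℕ) + y) - (N + y) / (N + (i + 1 : ℕ) + y) := by
  have h : (0 : ℝ) < N := by exact_mod_cast hN
  rw [gaussWeight]
  push_cast
  have h1 : (N : ℝ) + i + y ≠ 0 := by positivity
  have h2 : (N : ℝ) + i + 1 + y ≠ 0 := by positivity
  have h3 : (N : ℝ) + (i + 1) + y ≠ 0 := by positivity
  field_simp
  ring

theorem tendsto_div_natCast_add (a b : ℝ) :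
    Tendsto (fun n : ℕ => a / (N + n + b)) atTop (nhds 0) := by
  refine Tendsto.const_div_atTop ?_ a
  exact tendsto_atTop_add_const_right _ _
    (tendsto_atTop_add_const_left _ _ tendsto_natCast_atTop_atTop)

theorem hasSum_gaussWeight (hN : 0 < N) {y : ℝ} (hy : 0 ≤ y) :
    HasSum (fun i => gaussWeight N i y) 1 := by
  have h : (0 : ℝ) < N := by exact_mod_cast hN
  rw [hasSum_iff_tendsto_nat_of_nonneg fun i => gaussWeight_nonneg i hy]
  simp_rw [gaussWeight_eq_sub hN _ hy, Finset.sum_range_sub']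
  have := (tendsto_div_natCast_add (N := N) (N + y) y).const_sub ((N + y) / (N + (0 : ℕ) + y))
  simpa [div_self (by positivity : (N : ℝ) + y ≠ 0)] using this

theorem measurePreserving_gaussT (hN : 0 < N) :
    MeasurePreserving (gaussT N) (gaussMu N) (gaussMu N) := by
  refine ⟨measurable_gaussT N, Measure.ext fun s hs => ?_⟩
  rw [Measure.map_apply (measurable_gaussT N) hs,
    ← lintegral_indicator_one (measurable_gaussT N hs), ← lintegral_indicator_one hs,
    lintegral_gaussMu_eq_tsum hN (measurable_one.indicator (measurable_gaussT N hs)),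
    ← lintegral_tsum fun i => (measurable_gaussWeight_mul_comp i
      (measurable_one.indicator (measurable_gaussT N hs))).aemeasurable]
  refine lintegral_congr_ae ?_
  filter_upwards [ae_gaussMu_mem_Ico N] with y hy
  have hind (i : ℕ) : (gaussT N ⁻¹' s).indicator (1 : ℝ → ENNReal) (gaussBranch N i y) =
      s.indicator 1 y := by
    have hmem : gaussBranch N i y ∈ gaussT N ⁻¹' s ↔ y ∈ s := by
      rw [mem_preimage, gaussT_gaussBranch hN i hy]
    by_cases hy' : y ∈ s <;> simp only [hy', hmem, indicator_of_mem, indicator_of_notMem,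
      not_false_eq_true, Pi.one_apply]
  simp_rw [hind]
  rw [ENNReal.tsum_mul_right, ← ENNReal.ofReal_tsum_of_nonneg
    (fun i => gaussWeight_nonneg i hy.1) (hasSum_gaussWeight hN hy.1).summable,
    (hasSum_gaussWeight hN hy.1).tsum_eq, ENNReal.ofReal_one, one_mul]

theorem summable_gaussWeight_mul (hN : 0 < N) {f : ℝ → ℝ} {C : ℝ}
    (hf : ∀ x ∈ Icc (0 : ℝ) 1, |f x| ≤ C) {y : ℝ} (hy : 0 ≤ y) :
    Summable fun i => gaussWeight N i y * f (gaussBranch N i y) := by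
  refine ((hasSum_gaussWeight hN hy).summable.mul_right C).of_norm_bounded fun i => ?_
  rw [Real.norm_eq_abs, abs_mul, abs_of_nonneg (gaussWeight_nonneg i hy)]
  exact mul_le_mul_of_nonneg_left (hf _ (Ioc_subset_Icc_self (gaussBranch_mem_Ioc hN i hy)))
    (gaussWeight_nonneg i hy)

theorem gaussTransfer_add_const (hN : 0 < N) {f : ℝ → ℝ} {C : ℝ}
    (hf : ∀ x ∈ Icc (0 : ℝ) 1, |f x| ≤ C) (a : ℝ) {y : ℝ} (hy : 0 ≤ y) :
    gaussTransfer N (fun x => f x + a) y = gaussTransfer N f y + a := by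
  simp only [gaussTransfer, mul_add]
  rw [(summable_gaussWeight_mul hN hf hy).tsum_add
    ((hasSum_gaussWeight hN hy).summable.mul_right a), tsum_mul_right,
    (hasSum_gaussWeight hN hy).tsum_eq, one_mul]

theorem abs_gaussTransfer_le (hN : 0 < N) {f : ℝ → ℝ} {C : ℝ}
    (hf : ∀ x ∈ Icc (0 : ℝ) 1, |f x| ≤ C) {y : ℝ} (hy : 0 ≤ y) :
    |gaussTransfer N f y| ≤ C := by
  have hC := (hasSum_gaussWeight hN hy).mul_right C
  rw [one_mul] at hC
  rw [← Real.norm_eq_abs, gaussTransfer]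
  refine tsum_of_norm_bounded hC fun i => ?_
  rw [Real.norm_eq_abs, abs_mul, abs_of_nonneg (gaussWeight_nonneg i hy)]
  exact mul_le_mul_of_nonneg_left (hf _ (Ioc_subset_Icc_self (gaussBranch_mem_Ioc hN i hy)))
    (gaussWeight_nonneg i hy)

theorem integrable_gaussMu_of_abs_le (hN : 0 < N) {f : ℝ → ℝ} (hfm : Measurable f) {C : ℝ}
    (hf : ∀ x ∈ Icc (0 : ℝ) 1, |f x| ≤ C) : Integrable f (gaussMu N) := by
  have := isProbabilityMeasure_gaussMu hN
  refine Integrable.of_bound hfm.aestronglyMeasurable C ?_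
  filter_upwards [ae_gaussMu_mem_Ico N] with x hx
  exact hf x (Ico_subset_Icc_self hx)

theorem integral_gaussTransfer_of_nonneg (hN : 0 < N) {f : ℝ → ℝ} (hfm : Measurable f) {C : ℝ}
    (hf : ∀ x ∈ Icc (0 : ℝ) 1, |f x| ≤ C) (h0 : ∀ x ∈ Icc (0 : ℝ) 1, 0 ≤ f x) :
    ∫ y, gaussTransfer N f y ∂gaussMu N = ∫ x, f x ∂gaussMu N := by
  have hterm (i : ℕ) (y : ℝ) (hy : 0 ≤ y) : 0 ≤ gaussWeight N i y * f (gaussBranch N i y) :=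
    mul_nonneg (gaussWeight_nonneg i hy)
      (h0 _ (Ioc_subset_Icc_self (gaussBranch_mem_Ioc hN i hy)))
  rw [integral_eq_lintegral_of_nonneg_ae (f := f) _ hfm.aestronglyMeasurable,
    integral_eq_lintegral_of_nonneg_ae _ (measurable_gaussTransfer N hfm).aestronglyMeasurable,
    lintegral_gaussMu_eq_tsum hN hfm.ennreal_ofReal,
    ← lintegral_tsum fun i =>
      (measurable_gaussWeight_mul_comp i hfm.ennreal_ofReal).aemeasurable]
  · congr 1
    refine lintegral_congr_ae ?_
    filter_upwards [ae_gaussMu_mem_Ico N] with y hy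
    rw [gaussTransfer, ENNReal.ofReal_tsum_of_nonneg (fun i => hterm i y hy.1)
      (summable_gaussWeight_mul hN hf hy.1)]
    exact tsum_congr fun i => ENNReal.ofReal_mul (gaussWeight_nonneg i hy.1)
  · filter_upwards [ae_gaussMu_mem_Ico N] with y hy
    exact tsum_nonneg fun i => hterm i y hy.1
  · filter_upwards [ae_gaussMu_mem_Ico N] with x hx
    exact h0 x (Ico_subset_Icc_self hx)

theorem integral_gaussTransfer (hN : 0 < N) {f : ℝ → ℝ} (hfm : Measurable f) {C : ℝ}
    (hf : ∀ x ∈ Icc (0 : ℝ) 1, |f x| ≤ C) :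
    ∫ y, gaussTransfer N f y ∂gaussMu N = ∫ x, f x ∂gaussMu N := by
  have := isProbabilityMeasure_gaussMu hN
  have hC : 0 ≤ C := (abs_nonneg _).trans (hf 0 (by simp))
  have hP : Integrable (gaussTransfer N f) (gaussMu N) :=
    integrable_gaussMu_of_abs_le hN (measurable_gaussTransfer N hfm)
      fun y hy => abs_gaussTransfer_le hN hf hy.1
  have key := integral_gaussTransfer_of_nonneg hN (hfm.add_const C) (C := C + C)
    (fun x hx => (abs_add_le _ _).trans (by rw [abs_of_nonneg hC]; linarith [hf x hx]))
    (fun x hx => by linarith [neg_abs_le (f x), hf x hx])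
  have hcongr : ∫ y, gaussTransfer N (fun x => f x + C) y ∂gaussMu N =
      ∫ y, (gaussTransfer N f y + C) ∂gaussMu N := by
    refine integral_congr_ae ?_
    filter_upwards [ae_gaussMu_mem_Ico N] with y hy
    exact gaussTransfer_add_const hN hf C hy.1
  rw [hcongr, integral_add hP (integrable_const C),
    integral_add (integrable_gaussMu_of_abs_le hN hfm hf) (integrable_const C)] at key
  exact add_right_cancel key

theorem integral_gaussTransfer_mul (hN : 0 < N) {f g : ℝ → ℝ} (hfm : Measurable f)
    (hgm : Measurable g) {C D : ℝ} (hf : ∀ x ∈ Icc (0 : ℝ) 1, |f x| ≤ C)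
    (hg : ∀ x, |g x| ≤ D) (hinv : ∀ x, g (gaussT N x) = g x) :
    ∫ y, gaussTransfer N f y * g y ∂gaussMu N = ∫ x, f x * g x ∂gaussMu N := by
  change _ = ∫ x, (f * g) x ∂gaussMu N
  rw [← integral_gaussTransfer hN (hfm.mul hgm) (C := C * D) fun x hx => ?_]
  · refine integral_congr_ae ?_
    filter_upwards [ae_gaussMu_mem_Ico N] with y hy
    rw [gaussTransfer, gaussTransfer, ← tsum_mul_right]
    refine tsum_congr fun i => ?_
    rw [Pi.mul_apply, ← hinv (gaussBranch N i y), gaussT_gaussBranch hN i hy, mul_assoc]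
  · rw [Pi.mul_apply, abs_mul]
    exact mul_le_mul (hf x hx) (hg x) (abs_nonneg _) ((abs_nonneg _).trans (hf x hx))

theorem gaussBranch_antitone (hN : 0 < N) {i j : ℕ} (hij : i ≤ j) {y z : ℝ} (hy : 0 ≤ y)
    (hyz : y ≤ z) : gaussBranch N j z ≤ gaussBranch N i y := by
  have h : (0 : ℝ) < N := by exact_mod_cast hN
  have hij' : (i : ℝ) ≤ j := by exact_mod_cast hij
  unfold gaussBranch
  gcongr

theorem abs_le_of_monotoneOn {f : ℝ → ℝ} (hf : MonotoneOn f (Icc 0 1)) :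
    ∀ x ∈ Icc (0 : ℝ) 1, |f x| ≤ max |f 0| |f 1| := fun _ hx =>
  abs_le_max_abs_abs (hf (left_mem_Icc.2 zero_le_one) hx hx.1)
    (hf hx (right_mem_Icc.2 zero_le_one) hx.2)

theorem tail_gaussWeight_mono (hN : 0 < N) (n : ℕ) {y z : ℝ} (hy : 0 ≤ y) (hyz : y ≤ z) :
    (N + y) / (N + n + y) ≤ (N + z) / (N + n + z) := by
  have h : (0 : ℝ) < N := by exact_mod_cast hN
  have hn : (0 : ℝ) ≤ n := n.cast_nonneg
  have hz := hy.trans hyz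
  rw [div_le_div_iff₀ (by positivity) (by positivity)]
  nlinarith [mul_nonneg hn (sub_nonneg.2 hyz)]

/-- The transfer operator turns monotone functions into antitone ones. -/
theorem gaussTransfer_antitoneOn (hN : 0 < N) {f : ℝ → ℝ} (hf : MonotoneOn f (Icc 0 1)) :
    AntitoneOn (gaussTransfer N f) (Icc 0 1) := by
  intro y hy z hz hyz
  have hb := abs_le_of_monotoneOn hf
  have hmem (i : ℕ) {w : ℝ} (hw : 0 ≤ w) : gaussBranch N i w ∈ Icc (0 : ℝ) 1 :=
    Ioc_subset_Icc_self (gaussBranch_mem_Ioc hN i hw)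
  set b : ℕ → ℝ := fun i => f (gaussBranch N i y) with hb_def
  have hbanti (i : ℕ) : b (i + 1) ≤ b i :=
    hf (hmem _ hy.1) (hmem _ hy.1) (gaussBranch_antitone hN i.le_succ hy.1 le_rfl)
  have hb0 (i : ℕ) : f 0 ≤ b i :=
    hf (left_mem_Icc.2 zero_le_one) (hmem _ hy.1) (hmem i hy.1).1
  set D : ℕ → ℝ := fun n => (N + z) / (N + n + z) - (N + y) / (N + n + y) with hD
  have hD0 (n : ℕ) : 0 ≤ D n := sub_nonneg.2 (tail_gaussWeight_mono hN n hy.1 hyz)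
  have hsum : Summable fun i => gaussWeight N i z * b i := by
    refine ((hasSum_gaussWeight hN hz.1).summable.mul_right
      (max |f 0| |f 1|)).of_norm_bounded fun i => ?_
    rw [Real.norm_eq_abs, abs_mul, abs_of_nonneg (gaussWeight_nonneg i hz.1)]
    exact mul_le_mul_of_nonneg_left (hb _ (hmem i hy.1)) (gaussWeight_nonneg i hz.1)
  have hpart (n : ℕ) : D n * b n ≤
      ∑ i ∈ Finset.range n, (gaussWeight N i y * b i - gaussWeight N i z * b i) := by
    induction n with
    | zero =>
      have h : (0 : ℝ) < N := by exact_mod_cast hN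
      have h1 : (N : ℝ) + y ≠ 0 := by linarith [hy.1]
      have h2 : (N : ℝ) + z ≠ 0 := by linarith [hz.1]
      simp [hD, div_self h1, div_self h2]
    | succ n ih =>
      rw [Finset.sum_range_succ, gaussWeight_eq_sub hN n hy.1, gaussWeight_eq_sub hN n hz.1]
      have hstep := mul_le_mul_of_nonneg_left (hbanti n) (hD0 (n + 1))
      simp only [hD] at hstep ih ⊢
      linarith
  have hDlim : Tendsto (fun n => D n * f 0) atTop (nhds 0) := by
    simpa using ((tendsto_div_natCast_add (N := N) (N + z) z).sub
      (tendsto_div_natCast_add (N := N) (N + y) y)).mul_const (f 0)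
  have hsum' := summable_gaussWeight_mul hN hb hy.1
  have hlim := (hsum'.sub hsum).hasSum.tendsto_sum_nat
  have hle : gaussTransfer N f z ≤ ∑' i, gaussWeight N i z * b i :=
    (summable_gaussWeight_mul hN hb hz.1).tsum_le_tsum (fun i =>
      mul_le_mul_of_nonneg_left (hf (hmem _ hz.1) (hmem _ hy.1)
        (gaussBranch_antitone hN le_rfl hy.1 hyz)) (gaussWeight_nonneg i hz.1)) hsum
  have hge := le_of_tendsto_of_tendsto' hDlim hlim fun n =>
    (mul_le_mul_of_nonneg_left (hb0 n) (hD0 n)).trans (hpart n)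
  rw [hsum'.tsum_sub hsum] at hge
  exact hle.trans (sub_nonneg.1 hge)

/-- An increasing function whose image under the transfer operator is explicit, used as a scale
for oscillations. -/
noncomputable def gaussScale (N : ℕ) (x : ℝ) : ℝ := x / N + x / (N + x)

theorem gaussScale_sub (hN : 0 < N) {x y : ℝ} (hx : 0 ≤ x) (hxy : x ≤ y) :
    gaussScale N y - gaussScale N x = (y - x) / N + N * (y - x) / ((N + x) * (N + y)) := by
  have h : (0 : ℝ) < N := by exact_mod_cast hN
  have hy := hx.trans hxy
  have h1 : (N : ℝ) + x ≠ 0 := by positivity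
  have h2 : (N : ℝ) + y ≠ 0 := by positivity
  unfold gaussScale
  field_simp
  ring

theorem sub_div_le_gaussScale_sub (hN : 0 < N) {x y : ℝ} (hx : 0 ≤ x) (hxy : x ≤ y) :
    (y - x) / N ≤ gaussScale N y - gaussScale N x := by
  have hy := hx.trans hxy
  have := sub_nonneg.2 hxy
  rw [gaussScale_sub hN hx hxy]
  exact le_add_of_nonneg_right (by positivity)

theorem gaussScale_monotoneOn (hN : 0 < N) : MonotoneOn (gaussScale N) (Icc 0 1) :=
  fun _ hx _ _ hxy => sub_nonneg.1 <|
    (div_nonneg (sub_nonneg.2 hxy) N.cast_nonneg).trans (sub_div_le_gaussScale_sub hN hx.1 hxy)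

theorem gaussTransfer_gaussScale (hN : 0 < N) {y : ℝ} (hy : 0 ≤ y) :
    gaussTransfer N (gaussScale N) y = 1 / (N + y) := by
  have h : (0 : ℝ) < N := by exact_mod_cast hN
  have hNy : (N : ℝ) + y ≠ 0 := by positivity
  have hterm (i : ℕ) : gaussWeight N i y * gaussScale N (gaussBranch N i y) =
      (N + y) * ((1 / (N + (i : ℕ) + y)) ^ 2 - (1 / (N + (i + 1 : ℕ) + y)) ^ 2) := by
    rw [gaussWeight, gaussScale, gaussBranch]
    push_cast
    have h1 : (N : ℝ) + i + y ≠ 0 := by positivity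
    have h2 : (N : ℝ) + i + 1 + y ≠ 0 := by positivity
    have h3 : (N : ℝ) + (i + 1) + y ≠ 0 := by positivity
    have h4 : (N : ℝ) + N / (N + i + y) ≠ 0 := by positivity
    field_simp
    ring
  have hsum := (summable_gaussWeight_mul hN
    (abs_le_of_monotoneOn (gaussScale_monotoneOn hN)) hy).hasSum.tendsto_sum_nat
  refine tendsto_nhds_unique hsum ?_
  simp_rw [hterm, ← Finset.mul_sum, Finset.sum_range_sub']
  have := ((((tendsto_div_natCast_add (N := N) 1 y).pow 2).const_sub
    ((1 / (N + (0 : ℕ) + y)) ^ 2)).const_mul (N + y))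
  convert this using 2
  simp
  field_simp

theorem gaussTransfer_gaussScale_sub_le (hN : 0 < N) {x y : ℝ} (hx : 0 ≤ x) (hxy : x ≤ y) :
    gaussTransfer N (gaussScale N) x - gaussTransfer N (gaussScale N) y ≤
      (gaussScale N y - gaussScale N x) / 2 := by
  have h : (1 : ℝ) ≤ N := by exact_mod_cast hN
  have hy := hx.trans hxy
  have hd := sub_nonneg.2 hxy
  rw [gaussTransfer_gaussScale hN hx, gaussTransfer_gaussScale hN hy,
    gaussScale_sub hN hx hxy]
  have hD : 1 ≤ ((N : ℝ) + x) * (N + y) := by nlinarith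
  have hND : (N : ℝ) * N ≤ (N + x) * (N + y) := by nlinarith
  have h1 : 1 / (N + x) - 1 / (N + y) = (y - x) / ((N + x) * (N + y)) := by
    have h1 : (N : ℝ) + x ≠ 0 := by positivity
    have h2 : (N : ℝ) + y ≠ 0 := by positivity
    field_simp
    ring
  have h2 : (y - x) / ((N + x) * (N + y)) ≤ N * (y - x) / ((N + x) * (N + y)) := by
    gcongr
    nlinarith
  have h3 : (y - x) / ((N + x) * (N + y)) ≤ (y - x) / N := by
    gcongr
    nlinarith
  rw [h1]
  linarith

/-- `f` is `K`-Lipschitz on `[0, 1]` relative to `gaussScale N`. -/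
def GaussLipschitz (N : ℕ) (K : ℝ) (f : ℝ → ℝ) : Prop :=
  ∀ x y, 0 ≤ x → x ≤ y → y ≤ 1 → |f y - f x| ≤ K * (gaussScale N y - gaussScale N x)

theorem GaussLipschitz.nonneg (hN : 0 < N) {f : ℝ → ℝ} {K : ℝ} (hf : GaussLipschitz N K f) :
    0 ≤ K := by
  have h01 := (abs_nonneg _).trans (hf 0 1 le_rfl zero_le_one le_rfl)
  have hpos : 0 < gaussScale N 1 - gaussScale N 0 :=
    lt_of_lt_of_le (by simpa using hN) (sub_div_le_gaussScale_sub hN le_rfl zero_le_one)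
  exact nonneg_of_mul_nonneg_left h01 hpos

theorem GaussLipschitz.abs_sub_le (hN : 0 < N) {f : ℝ → ℝ} {K : ℝ} (hf : GaussLipschitz N K f)
    {x : ℝ} (hx : x ∈ Icc (0 : ℝ) 1) :
    |f x - f 0| ≤ K * (gaussScale N 1 - gaussScale N 0) := by
  refine (hf 0 x le_rfl hx.1 hx.2).trans (mul_le_mul_of_nonneg_left ?_ (hf.nonneg hN))
  linarith [gaussScale_monotoneOn hN hx (right_mem_Icc.2 zero_le_one) hx.2]

theorem GaussLipschitz.abs_le_add (hN : 0 < N) {f : ℝ → ℝ} {K : ℝ} (hf : GaussLipschitz N K f) :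
    ∀ x ∈ Icc (0 : ℝ) 1, |f x| ≤ |f 0| + K * (gaussScale N 1 - gaussScale N 0) := fun x hx => by
  linarith [hf.abs_sub_le hN hx, abs_sub_abs_le_abs_sub (f x) (f 0)]

/-- The transfer operator halves the Lipschitz constant relative to `gaussScale`. -/
theorem GaussLipschitz.transfer (hN : 0 < N) {f : ℝ → ℝ} {K : ℝ}
    (hf : GaussLipschitz N K f) : GaussLipschitz N (K / 2) (gaussTransfer N f) := by
  intro x y hx hxy hy
  have hxI : x ∈ Icc (0 : ℝ) 1 := ⟨hx, hxy.trans hy⟩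
  have hyI : y ∈ Icc (0 : ℝ) 1 := ⟨hx.trans hxy, hy⟩
  have hmono1 : MonotoneOn (fun t => K * gaussScale N t + f t) (Icc 0 1) := fun s hs t ht hst => by
    have := (abs_le.1 (hf s t hs.1 hst ht.2)).1
    change K * gaussScale N s + f s ≤ K * gaussScale N t + f t
    linarith
  have hmono2 : MonotoneOn (fun t => K * gaussScale N t - f t) (Icc 0 1) := fun s hs t ht hst => by
    have := (abs_le.1 (hf s t hs.1 hst ht.2)).2
    change K * gaussScale N s - f s ≤ K * gaussScale N t - f t
    linarith
  have hscale := abs_le_of_monotoneOn (gaussScale_monotoneOn hN)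
  have hs1 {w : ℝ} (hw : 0 ≤ w) := summable_gaussWeight_mul hN (abs_le_of_monotoneOn hmono1) hw
  have hs2 {w : ℝ} (hw : 0 ≤ w) := summable_gaussWeight_mul hN (abs_le_of_monotoneOn hmono2) hw
  have hs {w : ℝ} (hw : 0 ≤ w) := (summable_gaussWeight_mul hN hscale hw).mul_left K
  have heq1 {w : ℝ} (hw : 0 ≤ w) : gaussTransfer N (fun t => K * gaussScale N t + f t) w =
      K * gaussTransfer N (gaussScale N) w + gaussTransfer N f w := by
    have hsf : Summable fun i => gaussWeight N i w * f (gaussBranch N i w) :=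
      ((hs1 hw).sub (hs hw)).congr fun i => by ring
    simp only [gaussTransfer]
    rw [← tsum_mul_left, ← (hs hw).tsum_add hsf]
    exact tsum_congr fun i => by ring
  have heq2 {w : ℝ} (hw : 0 ≤ w) : gaussTransfer N (fun t => K * gaussScale N t - f t) w =
      K * gaussTransfer N (gaussScale N) w - gaussTransfer N f w := by
    have hsf : Summable fun i => gaussWeight N i w * f (gaussBranch N i w) :=
      ((hs1 hw).sub (hs hw)).congr fun i => by ring
    simp only [gaussTransfer]
    rw [← tsum_mul_left, ← (hs hw).tsum_sub hsf]
    exact tsum_congr fun i => by ring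
  have h1 := gaussTransfer_antitoneOn hN hmono1 hxI hyI hxy
  have h2 := gaussTransfer_antitoneOn hN hmono2 hxI hyI hxy
  rw [heq1 hxI.1, heq1 hyI.1] at h1
  rw [heq2 hxI.1, heq2 hyI.1] at h2
  have h3 := mul_le_mul_of_nonneg_left (gaussTransfer_gaussScale_sub_le hN hx hxy)
    (hf.nonneg hN)
  rw [abs_le]
  constructor <;> linarith

theorem abs_integral_mul_invariant_le (hN : 0 < N) {g : ℝ → ℝ} (hgm : Measurable g)
    (hg : ∀ x, |g x| ≤ 1) (hinv : ∀ x, g (gaussT N x) = g x) (hg0 : ∫ x, g x ∂gaussMu N = 0)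
    (n : ℕ) {f : ℝ → ℝ} (hfm : Measurable f) {K : ℝ} (hf : GaussLipschitz N K f) :
    |∫ x, f x * g x ∂gaussMu N| ≤ K * (gaussScale N 1 - gaussScale N 0) * (1 / 2) ^ n := by
  have hprob := isProbabilityMeasure_gaussMu hN
  induction n generalizing f K with
  | zero =>
    have hgi := integrable_gaussMu_of_abs_le hN hgm fun x _ => hg x
    have hfg : Integrable (fun x => f x * g x) (gaussMu N) :=
      (integrable_gaussMu_of_abs_le hN hfm (hf.abs_le_add hN)).mul_bdd hgm.aestronglyMeasurable
        (ae_of_all _ hg)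
    have heq : ∫ x, f x * g x ∂gaussMu N = ∫ x, (f x - f 0) * g x ∂gaussMu N := by
      simp_rw [sub_mul]
      rw [integral_sub hfg (hgi.const_mul _), integral_const_mul, hg0, mul_zero, sub_zero]
    rw [heq, pow_zero, mul_one]
    have := norm_integral_le_of_norm_le_const (μ := gaussMu N)
      (f := fun x => (f x - f 0) * g x) (C := K * (gaussScale N 1 - gaussScale N 0)) (by
        filter_upwards [ae_gaussMu_mem_Ico N] with x hx
        have h0 := hf.abs_sub_le hN (Ico_subset_Icc_self hx)
        rw [Real.norm_eq_abs, abs_mul]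
        exact (mul_le_of_le_one_right (abs_nonneg _) (hg x)).trans h0)
    simpa using this
  | succ n ih =>
    rw [← integral_gaussTransfer_mul hN hfm hgm (hf.abs_le_add hN) hg hinv]
    refine (ih (measurable_gaussTransfer N hfm) (hf.transfer hN)).trans_eq ?_
    ring

theorem integral_mul_invariant_eq_zero (hN : 0 < N) {g : ℝ → ℝ} (hgm : Measurable g)
    (hg : ∀ x, |g x| ≤ 1) (hinv : ∀ x, g (gaussT N x) = g x) (hg0 : ∫ x, g x ∂gaussMu N = 0)
    {f : ℝ → ℝ} {K : NNReal} (hf : LipschitzWith K f) : ∫ x, f x * g x ∂gaussMu N = 0 := by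
  have h : (0 : ℝ) < N := by exact_mod_cast hN
  have hf' : GaussLipschitz N (K * N) f := by
    intro x y hx hxy _
    have h1 := hf.dist_le_mul y x
    rw [Real.dist_eq, Real.dist_eq, abs_of_nonneg (sub_nonneg.2 hxy)] at h1
    refine h1.trans ?_
    rw [mul_assoc]
    refine mul_le_mul_of_nonneg_left ?_ K.coe_nonneg
    have h2 := sub_div_le_gaussScale_sub hN hx hxy
    rwa [div_le_iff₀' h] at h2
  have hlim : Tendsto (fun n : ℕ => K * N * (gaussScale N 1 - gaussScale N 0) * (1 / 2 : ℝ) ^ n)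
      atTop (nhds 0) := by
    simpa using (tendsto_pow_atTop_nhds_zero_of_lt_one (r := (1 / 2 : ℝ)) (by norm_num)
      (by norm_num)).const_mul (K * N * (gaussScale N 1 - gaussScale N 0))
  exact abs_nonpos_iff.1 (ge_of_tendsto' hlim fun n =>
    abs_integral_mul_invariant_le hN hgm hg hinv hg0 n hf.continuous.measurable hf')

theorem ergodic_gaussT (hN : 0 < N) : Ergodic (gaussT N) (gaussMu N) := by
  have hprob := isProbabilityMeasure_gaussMu hN
  refine ⟨measurePreserving_gaussT hN, ⟨fun s hs hinv => ?_⟩⟩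
  set c := (gaussMu N).real s
  set g : ℝ → ℝ := fun x => s.indicator 1 x - c with hg_def
  have hc0 : 0 ≤ c := measureReal_nonneg
  have hc1 : c ≤ 1 := measureReal_le_one
  have hgm : Measurable g := (measurable_one.indicator hs).sub_const c
  have hg (x : ℝ) : |g x| ≤ 1 := by
    by_cases hx : x ∈ s <;> simp [g, hx, abs_le] <;> constructor <;> linarith
  have hginv (x : ℝ) : g (gaussT N x) = g x := by
    have : gaussT N x ∈ s ↔ x ∈ s := by rw [← mem_preimage, hinv]
    by_cases hx : x ∈ s <;> simp [hg_def, hx, this]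
  have hgi : Integrable g (gaussMu N) := integrable_gaussMu_of_abs_le hN hgm fun x _ => hg x
  have hg0 : ∫ x, g x ∂gaussMu N = 0 := by
    have hind : Integrable (s.indicator (1 : ℝ → ℝ)) (gaussMu N) :=
      (integrable_const (1 : ℝ)).indicator hs
    calc ∫ x, (s.indicator 1 x - c) ∂gaussMu N
        = ∫ x, s.indicator 1 x ∂gaussMu N - ∫ _, c ∂gaussMu N :=
          integral_sub hind (integrable_const c)
      _ = 0 := by rw [integral_indicator_one hs]; simp [c]
  have hae := ae_eq_zero_of_integral_contDiff_smul_eq_zero hgi.locallyIntegrable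
    fun f hf hfs => by
      obtain ⟨K, hK⟩ := ContDiff.lipschitzWith_of_hasCompactSupport hfs hf (by simp)
      exact integral_mul_invariant_eq_zero hN hgm hg hginv hg0 hK
  rw [eventuallyConst_set']
  by_cases hc : c = 0
  · left
    filter_upwards [hae] with x hx
    refine propext (iff_of_false (fun hxs => ?_) id)
    simp [hg_def, show x ∈ s from hxs, hc] at hx
  · right
    filter_upwards [hae] with x hx
    refine propext (iff_of_true ?_ trivial)
    by_contra hxs
    have hxs' : x ∉ s := hxs
    simp [hg_def, hxs', hc] at hx

theorem volume_restrict_absolutelyContinuous_gaussMu (hN : 0 < N) :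
    (volume.restrict (Ico (0 : ℝ) 1)) ≪ gaussMu N := by
  have hc := gaussNorm_pos hN
  refine withDensity_absolutelyContinuous' (measurable_gaussDensity N).aemeasurable ?_
  filter_upwards [ae_restrict_mem measurableSet_Ico] with x hx
  have h : (0 : ℝ) < N := by exact_mod_cast hN
  have := hx.1
  exact (ENNReal.ofReal_pos.2 (by positivity)).ne'

theorem integral_gaussMu (hN : 0 < N) (φ : ℝ → ℝ) :
    ∫ y, φ y ∂gaussMu N =
      (1 / (Real.log (N + 1) - Real.log N)) * ∫ t in (0 : ℝ)..1, φ t / (N + t) := by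
  have hc := gaussNorm_pos hN
  rw [gaussMu, integral_withDensity_eq_integral_toReal_smul (measurable_gaussDensity N)
    (ae_of_all _ fun _ => ENNReal.ofReal_lt_top), intervalIntegral.integral_of_le zero_le_one,
    ← integral_Ico_eq_integral_Ioc, ← integral_const_mul]
  refine setIntegral_congr_fun measurableSet_Ico fun x hx => ?_
  have hx0 := hx.1
  have hpos : 0 ≤ 1 / ((Real.log (N + 1) - Real.log N) * (N + x)) := by positivity
  simp only [ENNReal.toReal_ofReal hpos, smul_eq_mul]
  rw [one_div_mul_eq_div, one_div_mul_eq_div, div_div, mul_comm ((N : ℝ) + x)]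

end GaussMap

/-- Birkhoff averages of a `μ_N`-integrable function converge, for Lebesgue
almost every `x ∈ [0,1)`, to `∫ φ dμ_N = (1/(log(N+1) - log N)) ∫_0^1 φ(t)/(N+t) dt`. -/
theorem gaussT_birkhoff (N : ℕ) (hN : 0 < N)
    (φ : ℝ → ℝ) (hmeas : Measurable φ) (hint : Integrable φ (gaussMu N)) :
    (∀ᵐ x ∂(volume.restrict (Set.Ico (0:ℝ) 1)),
      Tendsto (fun n : ℕ => (1 / (n : ℝ)) * ∑ k ∈ Finset.range n, φ ((gaussT N)^[k] x))
        atTop (nhds (∫ y, φ y ∂(gaussMu N)))) ∧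
    ∫ y, φ y ∂(gaussMu N)
      = (1 / (Real.log (N + 1) - Real.log N)) * ∫ t in (0:ℝ)..1, φ t / (N + t) := by

  have hprob := isProbabilityMeasure_gaussMu hN
  refine ⟨?_, integral_gaussMu hN φ⟩
  refine (volume_restrict_absolutelyContinuous_gaussMu hN).ae_le ?_
  filter_upwards [(ergodic_gaussT hN).ae_tendsto_birkhoffAverage hmeas hint] with x hx
  simpa only [birkhoffAverage, birkhoffSum, smul_eq_mul, one_div] using! hx
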